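/- arXiv:1110.0258 — 3 statements merged into one kernel-verified Lean document; each statement's English description precedes it below -/
import Mathlib

section
/- For any matrix T in the pseudo-unitary group U(s,s) (i.e. T* G T = G where G = diag(1,-1) in s×s blocks), there exists a unique unitary matrix S in U(2s) such that for all vectors a⁺, a⁻, b⁺, b⁻ in ℂ^s: T(a⁺,a⁻) = (b⁺,b⁻) if and only if S(a⁺,b⁻) = (a⁻,b⁺). -/
open Matrix

/-- The pseudo-unitary signature matrix G = diag(1, -1) in s×s blocks. -/
noncomputable def Gmat (s : ℕ) : Matrix (Fin s ⊕ Fin s) (Fin s ⊕ Fin s) ℂ :=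
  Matrix.fromBlocks 1 0 0 (-1)

/-- The block relations satisfied by a pseudo-unitary matrix. -/
theorem conjTranspose_mul_Gmat_mul_fromBlocks_eq {s : ℕ} {A B C D : Matrix (Fin s) (Fin s) ℂ}
    (h : (fromBlocks A B C D)ᴴ * Gmat s * fromBlocks A B C D = Gmat s) :
    Aᴴ * A = 1 + Cᴴ * C ∧ Aᴴ * B = Cᴴ * D ∧ Bᴴ * A = Dᴴ * C ∧ Dᴴ * D = 1 + Bᴴ * B := by
  simp only [Gmat, fromBlocks_conjTranspose, fromBlocks_multiply, fromBlocks_inj, Matrix.mul_one,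
    Matrix.mul_zero, Matrix.mul_neg, Matrix.neg_mul, add_zero, zero_add] at h
  obtain ⟨h₁, h₂, h₃, h₄⟩ := h
  refine ⟨?_, ?_, ?_, ?_⟩
  · rw [← h₁]; abel
  · rw [← sub_eq_zero, ← h₂]; abel
  · rw [← sub_eq_zero, ← h₃]; abel
  · rw [← sub_eq_zero, ← neg_eq_zero, ← add_neg_cancel (1 : Matrix (Fin s) (Fin s) ℂ), ← h₄]; abel

theorem isUnit_of_conjTranspose_mul_self_eq_one_add {n : Type*} [Fintype n] [DecidableEq n]
    {B D : Matrix n n ℂ} (h : Dᴴ * D = 1 + Bᴴ * B) : IsUnit D := by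
  open scoped ComplexOrder in
  have hu : IsUnit (Dᴴ * D) := by
    rw [h]
    exact (PosDef.one.add_posSemidef (posSemidef_conjTranspose_mul_self B)).isUnit
  rw [isUnit_iff_isUnit_det, det_mul] at hu
  exact (isUnit_iff_isUnit_det D).2 (isUnit_of_mul_isUnit_right hu)

theorem mul_inv_mem_unitaryGroup {n : Type*} [Fintype n] [DecidableEq n]
    {M N : Matrix n n ℂ} (hM : IsUnit M.det) (h : Nᴴ * N = Mᴴ * M) :
    N * M⁻¹ ∈ unitaryGroup n ℂ := by
  rw [mem_unitaryGroup_iff', star_eq_conjTranspose, conjTranspose_mul]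
  calc (M⁻¹)ᴴ * Nᴴ * (N * M⁻¹) = (M⁻¹)ᴴ * (Nᴴ * N) * M⁻¹ := by simp only [Matrix.mul_assoc]
    _ = (M * M⁻¹)ᴴ * (M * M⁻¹) := by rw [h, conjTranspose_mul]; simp only [Matrix.mul_assoc]
    _ = 1 := by rw [mul_nonsing_inv M hM]; simp

/-- For any T ∈ U(s,s) there is a unique unitary S ∈ U(2s) such that
    T(a⁺,a⁻) = (b⁺,b⁻) iff S(a⁺,b⁻) = (a⁻,b⁺). -/
theorem stmt0 (s : ℕ) (T : Matrix (Fin s ⊕ Fin s) (Fin s ⊕ Fin s) ℂ)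
    (hT : Tᴴ * Gmat s * T = Gmat s) :
    ∃! S : Matrix (Fin s ⊕ Fin s) (Fin s ⊕ Fin s) ℂ,
      S ∈ Matrix.unitaryGroup (Fin s ⊕ Fin s) ℂ ∧
      ∀ ap am bp bm : Fin s → ℂ,
        (T.mulVec (Sum.elim ap am) = Sum.elim bp bm ↔
         S.mulVec (Sum.elim ap bm) = Sum.elim am bp) := by
  obtain ⟨A, B, C, D, rfl⟩ : ∃ A B C D, T = fromBlocks A B C D :=
    ⟨_, _, _, _, (fromBlocks_toBlocks T).symm⟩
  obtain ⟨hA, hAB, hBA, hD⟩ := conjTranspose_mul_Gmat_mul_fromBlocks_eq hT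
  let M : Matrix (Fin s ⊕ Fin s) (Fin s ⊕ Fin s) ℂ := fromBlocks 1 0 C D
  let N : Matrix (Fin s ⊕ Fin s) (Fin s ⊕ Fin s) ℂ := fromBlocks 0 1 A B
  have hM : IsUnit M.det := by
    simpa [M, isUnit_iff_isUnit_det] using isUnit_of_conjTranspose_mul_self_eq_one_add hD
  have hT_apply (x y : Fin s → ℂ) : fromBlocks A B C D *ᵥ Sum.elim x y =
      Sum.elim (A *ᵥ x + B *ᵥ y) (C *ᵥ x + D *ᵥ y) := by simp [fromBlocks_mulVec]
  have hM_apply (x y : Fin s → ℂ) : M *ᵥ Sum.elim x y = Sum.elim x (C *ᵥ x + D *ᵥ y) := by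
    simp [M, fromBlocks_mulVec]
  have hN_apply (x y : Fin s → ℂ) : N *ᵥ Sum.elim x y = Sum.elim y (A *ᵥ x + B *ᵥ y) := by
    simp [N, fromBlocks_mulVec]
  refine ⟨N * M⁻¹, ⟨mul_inv_mem_unitaryGroup hM ?_, fun ap am bp bm ↦ ⟨fun h ↦ ?_, fun h ↦ ?_⟩⟩,
    fun S hS ↦ ?_⟩
  · simp [M, N, fromBlocks_conjTranspose, fromBlocks_multiply, hA, hAB, hBA, hD]
  · rw [hT_apply, Sum.elim_eq_iff] at h
    rw [← h.1, ← h.2, ← hM_apply, ← hN_apply, mulVec_mulVec, nonsing_inv_mul_cancel_right M N hM]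
  · obtain ⟨x, y, hxy⟩ : ∃ x y, M⁻¹ *ᵥ Sum.elim ap bm = Sum.elim x y :=
      ⟨_, _, (Sum.elim_comp_inl_inr _).symm⟩
    have hMxy : M *ᵥ Sum.elim x y = Sum.elim ap bm := by
      rw [← hxy, mulVec_mulVec, mul_nonsing_inv M hM, one_mulVec]
    rw [← mulVec_mulVec, hxy, hN_apply, Sum.elim_eq_iff] at h
    rw [hM_apply, Sum.elim_eq_iff] at hMxy
    rw [hT_apply, ← hMxy.1, ← h.1, h.2, hMxy.2]
  · have hSM : S * M = N := by
      refine ext_of_mulVec_single fun i ↦ ?_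
      rw [← Sum.elim_comp_inl_inr (Pi.single i (1 : ℂ)), ← mulVec_mulVec, hM_apply, hN_apply]
      exact (hS.2 _ _ _ _).1 (hT_apply _ _)
    rw [← hSM, mul_nonsing_inv_cancel_right M S hM]
end

section
/- Every matrix T in U(s,s) admits a polar-type decomposition T = diag(U_{r,+}, U_{r,-}) · [[√Q, √(Q-1)],[√(Q-1), √Q]] · diag(U_{l,+}, U_{l,-}), where Q is a real diagonal s×s matrix with Q ≥ 1 and U_{l,±}, U_{r,±} are unitary s×s matrices. -/
open Matrix

/-- A square matrix with pairwise orthogonal columns is a unitary matrix times the diagonal matrix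
of its column norms. -/
theorem exists_unitary_mul_diagonal_of_conjTranspose_mul_self_eq_diagonal
    {n : Type*} [Fintype n] [DecidableEq n] (N : Matrix n n ℂ) (d : n → ℝ)
    (hN : Nᴴ * N = diagonal fun i => (d i : ℂ)) :
    ∃ U ∈ unitaryGroup n ℂ, N = U * diagonal fun i => (Real.sqrt (d i) : ℂ) := by
  have hent (i j : n) : ∑ k, star (N k i) * N k j = if i = j then (d i : ℂ) else 0 := by
    simpa [mul_apply, diagonal_apply] using congrFun (congrFun hN i) j
  have hnorm (j : n) : ∑ k, ‖N k j‖ ^ 2 = d j := by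
    have h := hent j j
    simp only [RCLike.star_def, Complex.conj_mul', if_true] at h
    exact_mod_cast h
  have hd (j : n) : 0 ≤ d j := by rw [← hnorm]; positivity
  let v : n → EuclideanSpace ℂ n := fun j => WithLp.toLp 2 fun k => N k j / (Real.sqrt (d j) : ℂ)
  have hv : Orthonormal ℂ ({j | d j ≠ 0}.domRestrict v) := by
    rw [orthonormal_iff_ite]
    rintro ⟨i, hi⟩ ⟨j, hj⟩
    have hsq : (Real.sqrt (d i) : ℂ) * (Real.sqrt (d i) : ℂ) = d i := by
      exact_mod_cast Real.mul_self_sqrt (hd i)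
    have hinner : inner ℂ (v i) (v j) =
        (∑ k, star (N k i) * N k j) / ((Real.sqrt (d i) : ℂ) * (Real.sqrt (d j) : ℂ)) := by
      rw [Finset.sum_div, PiLp.inner_apply]
      refine Finset.sum_congr rfl fun k _ => ?_
      simp only [v, RCLike.inner_apply, RCLike.star_def, map_div₀, Complex.conj_ofReal]
      ring
    simp only [Set.domRestrict_apply, Subtype.mk.injEq]
    rw [hinner, hent]
    split_ifs with h
    · subst h
      rw [hsq]
      exact div_self (by exact_mod_cast hi)
    · simp
  obtain ⟨b, hb⟩ := hv.exists_orthonormalBasis_extension_of_card_eq (by simp)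
  refine ⟨of fun i j => b j i, ?_, ?_⟩
  · rw [mem_unitaryGroup_iff']
    ext i j
    have h := orthonormal_iff_ite.1 b.orthonormal i j
    simp only [PiLp.inner_apply, RCLike.inner_apply] at h
    simp only [star_eq_conjTranspose, mul_apply, conjTranspose_apply, of_apply, one_apply, ← h,
      RCLike.star_def]
    exact Finset.sum_congr rfl fun k _ => mul_comm _ _
  · ext i j
    rw [mul_diagonal, of_apply]
    by_cases hj : d j = 0
    · have h := hnorm j
      rw [hj, Finset.sum_eq_zero_iff_of_nonneg fun _ _ => by positivity] at h
      simpa [hj] using h i (Finset.mem_univ i)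
    · have hs : (Real.sqrt (d j) : ℂ) ≠ 0 := by
        exact_mod_cast (Real.sqrt_pos.2 ((hd j).lt_of_ne' hj)).ne'
      rw [hb j hj]
      exact (div_mul_cancel₀ _ hs).symm

/-- Singular value decomposition of a square complex matrix. -/
theorem exists_unitary_mul_diagonal_mul_unitary
    {n : Type*} [Fintype n] [DecidableEq n] (B : Matrix n n ℂ) :
    ∃ U ∈ unitaryGroup n ℂ, ∃ V ∈ unitaryGroup n ℂ, ∃ σ : n → ℝ, (∀ i, 0 ≤ σ i) ∧
      B = U * (diagonal fun i => (σ i : ℂ)) * V := by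
  have hB := isHermitian_conjTranspose_mul_self B
  let W := hB.eigenvectorUnitary
  have hspec : (B * (W : Matrix n n ℂ))ᴴ * (B * (W : Matrix n n ℂ)) =
      diagonal fun i => (hB.eigenvalues i : ℂ) := by
    have h := hB.conjStarAlgAut_star_eigenvectorUnitary
    rw [Unitary.conjStarAlgAut_star_apply] at h
    rw [conjTranspose_mul]
    simpa [Matrix.mul_assoc, star_eq_conjTranspose, Function.comp_def] using h
  obtain ⟨U, hU, h⟩ :=
    exists_unitary_mul_diagonal_of_conjTranspose_mul_self_eq_diagonal _ _ hspec
  refine ⟨U, hU, star (W : Matrix n n ℂ), (star W).2, fun i => Real.sqrt (hB.eigenvalues i),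
    fun i => Real.sqrt_nonneg _, ?_⟩
  rw [← h, Matrix.mul_assoc, Unitary.mul_star_self_of_mem W.2, Matrix.mul_one]

/-- Every T ∈ U(s,s) admits the polar-type decomposition
    T = diag(U_{r,+}, U_{r,-}) · [[√Q, √(Q-1)],[√(Q-1), √Q]] · diag(U_{l,+}, U_{l,-})
    with Q real diagonal, Q ≥ 1, and the four U's unitary. -/
theorem stmt2 (s : ℕ) (T : Matrix (Fin s ⊕ Fin s) (Fin s ⊕ Fin s) ℂ)
    (hT : Tᴴ * Gmat s * T = Gmat s) :
    ∃ (Q : Fin s → ℝ) (Urp Urm Ulp Ulm : Matrix (Fin s) (Fin s) ℂ),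
      (∀ i, 1 ≤ Q i) ∧
      Urp ∈ Matrix.unitaryGroup (Fin s) ℂ ∧ Urm ∈ Matrix.unitaryGroup (Fin s) ℂ ∧
      Ulp ∈ Matrix.unitaryGroup (Fin s) ℂ ∧ Ulm ∈ Matrix.unitaryGroup (Fin s) ℂ ∧
      T = Matrix.fromBlocks Urp 0 0 Urm *
          Matrix.fromBlocks
            (Matrix.diagonal fun i => (Real.sqrt (Q i) : ℂ))
            (Matrix.diagonal fun i => (Real.sqrt (Q i - 1) : ℂ))
            (Matrix.diagonal fun i => (Real.sqrt (Q i - 1) : ℂ))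
            (Matrix.diagonal fun i => (Real.sqrt (Q i) : ℂ)) *
          Matrix.fromBlocks Ulp 0 0 Ulm := by
  obtain ⟨A, B, C, D, rfl⟩ : ∃ A B C D, T = fromBlocks A B C D :=
    ⟨_, _, _, _, (fromBlocks_toBlocks T).symm⟩
  have hGG : Gmat s * Gmat s = 1 := by
    simp [Gmat, fromBlocks_multiply]
  have hT' : fromBlocks A B C D * Gmat s * (fromBlocks A B C D)ᴴ = Gmat s := by
    have h : Gmat s * (fromBlocks A B C D)ᴴ * Gmat s * fromBlocks A B C D = 1 := by
      rw [Matrix.mul_assoc, Matrix.mul_assoc, ← Matrix.mul_assoc _ (Gmat s), hT, hGG]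
    have h' : fromBlocks A B C D * (Gmat s * (fromBlocks A B C D)ᴴ * Gmat s) = 1 :=
      mul_eq_one_comm.1 h
    calc _ = fromBlocks A B C D * (Gmat s * (fromBlocks A B C D)ᴴ * Gmat s) * Gmat s := by
          simp only [Matrix.mul_assoc, hGG, Matrix.mul_one]
      _ = Gmat s := by rw [h', Matrix.one_mul]
  simp only [Gmat, fromBlocks_conjTranspose, fromBlocks_multiply, Matrix.mul_zero, Matrix.mul_one,
    add_zero, zero_add, Matrix.mul_neg, Matrix.neg_mul, fromBlocks_inj] at hT hT'
  have hA : A * Aᴴ = 1 + B * Bᴴ := by rw [← hT'.1]; abel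
  have hD : Dᴴ * D = 1 + Bᴴ * B := by
    rw [← neg_neg (1 : Matrix (Fin s) (Fin s) ℂ), ← hT.2.2.2]; abel
  have hC : Dᴴ * C = Bᴴ * A := by
    rw [eq_comm, ← sub_eq_zero, sub_eq_add_neg]; exact hT.2.2.1
  clear hT hT' hGG
  obtain ⟨U, hU, V, hV, σ, hσ, hB⟩ := exists_unitary_mul_diagonal_mul_unitary B
  have hUU := mem_unitaryGroup_iff.1 hU
  have hUU' := mem_unitaryGroup_iff'.1 hU
  have hVV := mem_unitaryGroup_iff.1 hV
  have hVV' := mem_unitaryGroup_iff'.1 hV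
  rw [star_eq_conjTranspose] at hUU hUU' hVV hVV'
  let c : Fin s → ℝ := fun i => Real.sqrt (1 + σ i ^ 2)
  have hc (i) : (c i : ℂ) ≠ 0 := by
    have : 0 < c i := Real.sqrt_pos.2 (by positivity)
    exact_mod_cast this.ne'
  have hcc (i) : (c i : ℂ) * c i = 1 + σ i * σ i := by
    have : c i * c i = 1 + σ i * σ i := by
      rw [← sq (σ i)]; exact Real.mul_self_sqrt (by positivity)
    exact_mod_cast this
  let S : Matrix (Fin s) (Fin s) ℂ := diagonal fun i => (σ i : ℂ)
  let K : Matrix (Fin s) (Fin s) ℂ := diagonal fun i => (c i : ℂ)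
  let J : Matrix (Fin s) (Fin s) ℂ := diagonal fun i => (c i : ℂ)⁻¹
  have hSH : Sᴴ = S := by
    simp [S, diagonal_conjTranspose, Pi.star_def]
  have hKH : Kᴴ = K := by
    simp [K, diagonal_conjTranspose, Pi.star_def]
  have hJH : Jᴴ = J := by
    simp [J, diagonal_conjTranspose, Pi.star_def]
  have hKJ : K * J = 1 := by simp [K, J, hc]
  have hJK : J * K = 1 := by simp [K, J, hc]
  have hKK : K * K = 1 + S * S := by
    simp only [K, S, diagonal_mul_diagonal, hcc, ← diagonal_one, diagonal_add]
  have hKS : K * S = S * K := by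
    simp only [K, S, diagonal_mul_diagonal, mul_comm]
  change B = U * S * V at hB
  have hJKKJ : J * (K * K) * J = 1 := by
    rw [← Matrix.mul_assoc, hJK, Matrix.one_mul, hKJ]
  have hBB : B * Bᴴ = U * (S * S) * Uᴴ := by
    rw [hB]
    simp only [conjTranspose_mul, hSH]
    calc _ = U * S * (V * Vᴴ) * S * Uᴴ := by simp only [Matrix.mul_assoc]
      _ = _ := by rw [hVV]; simp only [Matrix.mul_assoc, Matrix.mul_one]
  have hBB' : Bᴴ * B = Vᴴ * (S * S) * V := by
    rw [hB]
    simp only [conjTranspose_mul, hSH]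
    calc _ = Vᴴ * S * (Uᴴ * U) * S * V := by simp only [Matrix.mul_assoc]
      _ = _ := by rw [hUU']; simp only [Matrix.mul_assoc, Matrix.mul_one]
  have hAK : Uᴴ * (A * Aᴴ) * U = K * K := by
    rw [hA, hBB, Matrix.mul_add, Matrix.add_mul, Matrix.mul_one, hUU', hKK]
    congr 1
    calc _ = (Uᴴ * U) * (S * S) * (Uᴴ * U) := by simp only [Matrix.mul_assoc]
      _ = _ := by rw [hUU', Matrix.one_mul, Matrix.mul_one]
  have hDK : V * (Dᴴ * D) * Vᴴ = K * K := by
    rw [hD, hBB', Matrix.mul_add, Matrix.add_mul, Matrix.mul_one, hVV, hKK]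
    congr 1
    calc _ = (V * Vᴴ) * (S * S) * (V * Vᴴ) := by simp only [Matrix.mul_assoc]
      _ = _ := by rw [hVV, Matrix.one_mul, Matrix.mul_one]
  have hP : J * Uᴴ * A ∈ unitaryGroup (Fin s) ℂ := by
    rw [mem_unitaryGroup_iff, star_eq_conjTranspose]
    simp only [conjTranspose_mul, conjTranspose_conjTranspose, hJH]
    rw [← hJKKJ, ← hAK]
    simp only [Matrix.mul_assoc]
  have hM : D * Vᴴ * J ∈ unitaryGroup (Fin s) ℂ := by
    rw [mem_unitaryGroup_iff', star_eq_conjTranspose]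
    simp only [conjTranspose_mul, conjTranspose_conjTranspose, hJH]
    rw [← hJKKJ, ← hDK]
    simp only [Matrix.mul_assoc]
  have hA_eq : A = U * K * (J * Uᴴ * A) := by
    calc A = U * (K * J) * Uᴴ * A := by rw [hKJ, Matrix.mul_one, hUU, Matrix.one_mul]
      _ = _ := by simp only [Matrix.mul_assoc]
  have hD_eq : D = D * Vᴴ * J * K * V := by
    calc D = D * (Vᴴ * (J * K) * V) := by rw [hJK, Matrix.mul_one, hVV', Matrix.mul_one]
      _ = _ := by simp only [Matrix.mul_assoc]
  generalize J * Uᴴ * A = P at hP hA_eq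
  generalize D * Vᴴ * J = M at hM hD_eq
  have hMM := mem_unitaryGroup_iff.1 hM
  have hMM' := mem_unitaryGroup_iff'.1 hM
  rw [star_eq_conjTranspose] at hMM hMM'
  have hC_eq : C = M * S * P := by
    have hDH : Dᴴ = Vᴴ * K * Mᴴ := by
      rw [hD_eq]; simp only [conjTranspose_mul, hKH, Matrix.mul_assoc]
    have hBA : Bᴴ * A = Vᴴ * (K * S) * P := by
      rw [hB, hA_eq, hKS]
      simp only [conjTranspose_mul, hSH]
      calc _ = Vᴴ * S * (Uᴴ * U) * K * P := by simp only [Matrix.mul_assoc]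
        _ = _ := by rw [hUU']; simp only [Matrix.mul_assoc, Matrix.mul_one]
    rw [hDH, hBA] at hC
    have hinv : M * J * V * (Vᴴ * K * Mᴴ) = 1 := by
      calc _ = M * (J * (V * Vᴴ) * K) * Mᴴ := by simp only [Matrix.mul_assoc]
        _ = 1 := by rw [hVV, Matrix.mul_one, hJK, Matrix.mul_one, hMM]
    calc C = M * J * V * (Vᴴ * K * Mᴴ * C) := by
          rw [← Matrix.mul_assoc, hinv, Matrix.one_mul]
      _ = M * (J * (V * Vᴴ) * K) * S * P := by rw [hC]; simp only [Matrix.mul_assoc]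
      _ = M * S * P := by rw [hVV, Matrix.mul_one, hJK, Matrix.mul_one]
  refine ⟨fun i => 1 + σ i ^ 2, U, M, P, V, fun i => by nlinarith [sq_nonneg (σ i)],
    hU, hM, hP, hV, ?_⟩
  have hsqrt (i) : Real.sqrt (1 + σ i ^ 2 - 1) = σ i := by
    rw [add_sub_cancel_left, Real.sqrt_sq (hσ i)]
  simp only [hsqrt]
  change fromBlocks A B C D = _ * fromBlocks K S S K * _
  simp only [fromBlocks_multiply, Matrix.mul_zero, Matrix.zero_mul, add_zero, zero_add]
  rw [← hA_eq, ← hB, ← hC_eq, ← hD_eq]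
end

section
/- Define A_E = P₂ M⁻¹ 𝒯^E_{0,L} M P₂* (compression of the conjugated transfer matrix to the hyperbolic block) as a function of E on an interval I free of parabolic channels. Then E ↦ A_E extends to a function analytic in E on the strip I + iℝ, and det(A_E) vanishes at only finitely many points of I; hence A_E is invertible for all but finitely many E ∈ I. -/
open Matrix


open Matrix

/-- The basis-change matrix M from the paper (eq. (18)), in four blocks of sizes
    s, h, s, h, built from the elliptic data k and hyperbolic data γ, u and the
    unitary U diagonalizing W. -/
noncomputable def Mmat (s h : ℕ) (k : Fin s → ℝ) (γ u : Fin h → ℝ)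
    (U : Matrix (Fin s ⊕ Fin h) (Fin s ⊕ Fin h) ℂ) :
    Matrix ((Fin s ⊕ Fin h) ⊕ (Fin s ⊕ Fin h)) ((Fin s ⊕ Fin h) ⊕ (Fin s ⊕ Fin h)) ℂ :=
  Matrix.fromBlocks U 0 0 U *
  Matrix.fromBlocks
    (Matrix.fromBlocks
      (Matrix.diagonal fun i => (((Real.sqrt (Real.sin (k i)))⁻¹ : ℝ) : ℂ)) 0 0
      (Matrix.diagonal fun j => ((u j * (Real.sqrt (2 * Real.sinh (γ j)))⁻¹ : ℝ) : ℂ)))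
    (Matrix.fromBlocks 0 0 0
      (Matrix.diagonal fun j => (((Real.sqrt (2 * Real.sinh (γ j)))⁻¹ : ℝ) : ℂ)))
    (Matrix.fromBlocks
      (Matrix.diagonal fun i =>
        ((Real.cos (k i) * (Real.sqrt (Real.sin (k i)))⁻¹ : ℝ) : ℂ)) 0 0
      (Matrix.diagonal fun j =>
        ((Real.exp (-γ j) * (Real.sqrt (2 * Real.sinh (γ j)))⁻¹ : ℝ) : ℂ)))
    (Matrix.fromBlocks
      (Matrix.diagonal fun i => ((Real.sqrt (Real.sin (k i)) : ℝ) : ℂ)) 0 0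
      (Matrix.diagonal fun j =>
        ((u j * Real.exp (γ j) * (Real.sqrt (2 * Real.sinh (γ j)))⁻¹ : ℝ) : ℂ)))

/-- The (N−s)×2N matrix (0 1 0 0) extracting the second (hyperbolic) block. -/
noncomputable def P2 (s h : ℕ) : Matrix (Fin h) ((Fin s ⊕ Fin h) ⊕ (Fin s ⊕ Fin h)) ℂ :=
  Matrix.of fun i j => match j with
    | Sum.inl (Sum.inr b) => if i = b then 1 else 0
    | _ => 0

/-- `e^γ` as an analytic function of `x = 2 cosh γ` on the half-plane `2 < Re x`. -/
noncomputable def growthFactor (x : ℂ) : ℂ :=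
  ((Complex.exp (Complex.log (x + 2) / 2) + Complex.exp (Complex.log (x - 2) / 2)) / 2) ^ 2

/-- `e^{-γ}` as an analytic function of `x = 2 cosh γ` on the half-plane `2 < Re x`. -/
noncomputable def decayFactor (x : ℂ) : ℂ :=
  ((Complex.exp (Complex.log (x + 2) / 2) - Complex.exp (Complex.log (x - 2) / 2)) / 2) ^ 2

/-- `(2 sinh γ)^{-1/2}` as an analytic function of `x = 2 cosh γ` on the half-plane
`2 < Re x`. -/
noncomputable def hypNormalizer (x : ℂ) : ℂ :=
  Complex.exp (-(Complex.log (x + 2) + Complex.log (x - 2)) / 4)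

lemma exp_half_log_sq {y : ℂ} (hy : y ≠ 0) : Complex.exp (Complex.log y / 2) ^ 2 = y := by
  rw [← Complex.exp_nat_mul]
  push_cast
  rw [mul_div_cancel₀ _ two_ne_zero, Complex.exp_log hy]

lemma exp_half_log_re_pos {y : ℂ} (hy : 0 < y.re) :
    0 < (Complex.exp (Complex.log y / 2)).re := by
  have h2 : (Complex.log y / 2).im = y.arg / 2 := by
    simp [Complex.log_im]
  rw [Complex.exp_re, h2]
  refine mul_pos (Real.exp_pos _) (Real.cos_pos_of_mem_Ioo ?_)
  have h := abs_lt.1 (Complex.abs_arg_lt_pi_div_two_iff.2 (Or.inl hy))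
  constructor <;> linarith [h.1, h.2, Real.pi_pos]

lemma decayFactor_mul_growthFactor {x : ℂ} (hx : 2 < x.re) :
    decayFactor x * growthFactor x = 1 := by
  have h1 : x - 2 ≠ 0 := fun h => by
    have := congrArg Complex.re h
    simp at this
    linarith
  have h2 : x + 2 ≠ 0 := fun h => by
    have := congrArg Complex.re h
    simp at this
    linarith
  have e1 := exp_half_log_sq h1
  have e2 := exp_half_log_sq h2
  unfold decayFactor growthFactor
  set a := Complex.exp (Complex.log (x - 2) / 2)
  set b := Complex.exp (Complex.log (x + 2) / 2)
  have : ((b - a) / 2) ^ 2 * ((b + a) / 2) ^ 2 = (b ^ 2 - a ^ 2) ^ 2 / 16 := by ring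
  rw [this, e1, e2]
  ring

lemma norm_sub_two_le_growthFactor {x : ℂ} (hx : 2 < x.re) :
    ‖x - 2‖ ≤ 8 * ‖growthFactor x‖ := by
  have p1 : 0 < (x - 2).re := by simpa using hx
  have p2 : 0 < (x + 2).re := by
    have : (x + 2).re = x.re + 2 := by simp
    linarith
  have h1 : x - 2 ≠ 0 := fun h => by simp [h] at p1
  have e1 := exp_half_log_sq h1
  have r1 := exp_half_log_re_pos p1
  have r2 := exp_half_log_re_pos p2
  unfold growthFactor
  set a := Complex.exp (Complex.log (x - 2) / 2)
  set b := Complex.exp (Complex.log (x + 2) / 2)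
  have hab : 0 < a.re ^ 2 - a.im ^ 2 := by
    rw [← e1] at p1
    simpa [sq] using p1
  have n1 : ‖a‖ ^ 2 = a.re ^ 2 + a.im ^ 2 := by
    rw [Complex.sq_norm, Complex.normSq_apply]; ring
  have n2 : ‖b + a‖ ^ 2 = (b.re + a.re) ^ 2 + (b.im + a.im) ^ 2 := by
    rw [Complex.sq_norm, Complex.normSq_apply]; simp; ring
  rw [← e1, norm_pow, norm_pow, norm_div, div_pow, n1, n2]
  norm_num
  nlinarith [mul_pos r1 r2, sq_nonneg (b.im + a.im), sq_nonneg b.re]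

lemma mem_slitPlane_of_two_lt_re {x : ℂ} (hx : 2 < x.re) :
    x - 2 ∈ Complex.slitPlane ∧ x + 2 ∈ Complex.slitPlane := by
  constructor <;> left
  · simpa using hx
  · have : (x + 2).re = x.re + 2 := by simp
    linarith

lemma analyticAt_growthFactor {x : ℂ} (hx : 2 < x.re) : AnalyticAt ℂ growthFactor x := by
  obtain ⟨h1, h2⟩ := mem_slitPlane_of_two_lt_re hx
  unfold growthFactor
  fun_prop (disch := assumption)

lemma analyticAt_decayFactor {x : ℂ} (hx : 2 < x.re) : AnalyticAt ℂ decayFactor x := by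
  obtain ⟨h1, h2⟩ := mem_slitPlane_of_two_lt_re hx
  unfold decayFactor
  fun_prop (disch := assumption)

lemma analyticAt_hypNormalizer {x : ℂ} (hx : 2 < x.re) : AnalyticAt ℂ hypNormalizer x := by
  obtain ⟨h1, h2⟩ := mem_slitPlane_of_two_lt_re hx
  unfold hypNormalizer
  fun_prop (disch := assumption)

lemma two_cosh_add_two (g : ℝ) : 2 * Real.cosh g + 2 = (2 * Real.cosh (g / 2)) ^ 2 := by
  have h := Real.cosh_two_mul (g / 2)
  rw [mul_div_cancel₀ _ two_ne_zero] at h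
  nlinarith [Real.cosh_sq (g / 2)]

lemma two_cosh_sub_two (g : ℝ) : 2 * Real.cosh g - 2 = (2 * Real.sinh (g / 2)) ^ 2 := by
  have h := Real.cosh_two_mul (g / 2)
  rw [mul_div_cancel₀ _ two_ne_zero] at h
  nlinarith [Real.cosh_sq (g / 2)]

lemma log_two_cosh_add_two (g : ℝ) :
    Complex.log (((2 * Real.cosh g : ℝ) : ℂ) + 2)
      = ((2 * Real.log (2 * Real.cosh (g / 2)) : ℝ) : ℂ) := by
  have : ((2 * Real.cosh g : ℝ) : ℂ) + 2 = ((2 * Real.cosh g + 2 : ℝ) : ℂ) := by push_cast; rfl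
  rw [this, two_cosh_add_two, ← Complex.ofReal_log (sq_nonneg _), Real.log_pow]
  norm_num

lemma log_two_cosh_sub_two (g : ℝ) :
    Complex.log (((2 * Real.cosh g : ℝ) : ℂ) - 2)
      = ((2 * Real.log (2 * Real.sinh (g / 2)) : ℝ) : ℂ) := by
  have : ((2 * Real.cosh g : ℝ) : ℂ) - 2 = ((2 * Real.cosh g - 2 : ℝ) : ℂ) := by push_cast; rfl
  rw [this, two_cosh_sub_two, ← Complex.ofReal_log (sq_nonneg _), Real.log_pow]
  norm_num

lemma exp_half_ofReal_two_mul_log {y : ℝ} (hy : 0 < y) :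
    Complex.exp (((2 * Real.log y : ℝ) : ℂ) / 2) = y := by
  have : ((2 * Real.log y : ℝ) : ℂ) / 2 = (Real.log y : ℂ) := by push_cast; ring
  rw [this, ← Complex.ofReal_exp, Real.exp_log hy]

lemma growthFactor_two_cosh {g : ℝ} (hg : 0 < g) :
    growthFactor ((2 * Real.cosh g : ℝ) : ℂ) = (Real.exp g : ℂ) := by
  have hs : 0 < Real.sinh (g / 2) := Real.sinh_pos_iff.2 (by linarith)
  have hc : 0 < Real.cosh (g / 2) := Real.cosh_pos _
  rw [growthFactor, log_two_cosh_add_two, log_two_cosh_sub_two,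
    exp_half_ofReal_two_mul_log (by positivity), exp_half_ofReal_two_mul_log (by positivity)]
  norm_cast
  rw [← mul_add, mul_div_cancel_left₀ _ two_ne_zero, Real.cosh_add_sinh, ← Real.exp_nat_mul]
  congr 1
  push_cast
  ring

lemma decayFactor_two_cosh {g : ℝ} (hg : 0 < g) :
    decayFactor ((2 * Real.cosh g : ℝ) : ℂ) = (Real.exp (-g) : ℂ) := by
  have hs : 0 < Real.sinh (g / 2) := Real.sinh_pos_iff.2 (by linarith)
  have hc : 0 < Real.cosh (g / 2) := Real.cosh_pos _
  rw [decayFactor, log_two_cosh_add_two, log_two_cosh_sub_two,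
    exp_half_ofReal_two_mul_log (by positivity), exp_half_ofReal_two_mul_log (by positivity)]
  norm_cast
  rw [← mul_sub, mul_div_cancel_left₀ _ two_ne_zero, Real.cosh_sub_sinh, ← Real.exp_nat_mul]
  congr 1
  push_cast
  ring

lemma hypNormalizer_two_cosh {g : ℝ} (hg : 0 < g) :
    hypNormalizer ((2 * Real.cosh g : ℝ) : ℂ) = ((Real.sqrt (2 * Real.sinh g))⁻¹ : ℝ) := by
  have hs : 0 < Real.sinh (g / 2) := Real.sinh_pos_iff.2 (by linarith)
  have hc : 0 < Real.cosh (g / 2) := Real.cosh_pos _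
  have hsinh : 2 * Real.sinh g = 2 * Real.cosh (g / 2) * (2 * Real.sinh (g / 2)) := by
    have h := Real.sinh_two_mul (g / 2)
    rw [mul_div_cancel₀ _ two_ne_zero] at h
    rw [h]; ring
  have hpos : 0 < 2 * Real.sinh g := by rw [hsinh]; positivity
  rw [hypNormalizer, log_two_cosh_add_two, log_two_cosh_sub_two]
  have : -(((2 * Real.log (2 * Real.cosh (g / 2)) : ℝ) : ℂ)
      + ((2 * Real.log (2 * Real.sinh (g / 2)) : ℝ) : ℂ)) / 4
      = ((-(Real.log (2 * Real.sinh g) / 2) : ℝ) : ℂ) := by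
    rw [hsinh, Real.log_mul (x := 2 * Real.cosh (g / 2)) (by positivity) (by positivity)]
    push_cast
    ring
  rw [this, ← Complex.ofReal_exp, Real.exp_neg, Real.exp_half, Real.exp_log hpos]

/-- The product of transfer matrices at complex energy. -/
noncomputable def transferProd {n : Type*} [Fintype n] [DecidableEq n] (V : ℕ → Matrix n n ℂ)
    (L : ℕ) (z : ℂ) : Matrix (n ⊕ n) (n ⊕ n) ℂ :=
  ((List.range L).reverse.map fun m => Matrix.fromBlocks (V m - z • 1) (-1) 1 0).prod

lemma transferProd_succ {n : Type*} [Fintype n] [DecidableEq n] (V : ℕ → Matrix n n ℂ)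
    (L : ℕ) (z : ℂ) :
    transferProd V (L + 1) z
      = Matrix.fromBlocks (V L - z • 1) (-1) 1 0 * transferProd V L z := by
  simp [transferProd, List.range_succ]

lemma analyticAt_transferProd {n : Type*} [Fintype n] [DecidableEq n] (V : ℕ → Matrix n n ℂ)
    (L : ℕ) (z : ℂ) (i j : n ⊕ n) : AnalyticAt ℂ (fun w => transferProd V L w i j) z := by
  induction L generalizing i j with
  | zero => simp only [transferProd, List.range_zero]; exact analyticAt_const
  | succ L ih =>
    simp only [transferProd_succ, Matrix.mul_apply]
    refine Finset.analyticAt_fun_sum _ fun l _ => AnalyticAt.mul ?_ (ih l j)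
    rcases i with i | i <;> rcases l with l | l <;> simp <;> fun_prop

open Filter Topology in
/-- The normalized product of transfer matrices converges at infinity to a matrix whose upper left
block is the identity. -/
lemma exists_tendsto_transferProd {n : Type*} [Fintype n] [DecidableEq n] (V : ℕ → Matrix n n ℂ)
    (L : ℕ) {z : ℝ → ℂ} (hz : Tendsto (fun t => (-z t)⁻¹) atTop (𝓝 0))
    (hz0 : ∀ᶠ t in atTop, z t ≠ 0) :
    ∃ P : Matrix (n ⊕ n) (n ⊕ n) ℂ, P.toBlocks₁₁ = 1 ∧
      Tendsto (fun t => ((-z t)⁻¹) ^ L • transferProd V L (z t)) atTop (𝓝 P) := by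
  induction L with
  | zero =>
    refine ⟨1, by rw [← Matrix.fromBlocks_one, Matrix.toBlocks_fromBlocks₁₁], ?_⟩
    simp [transferProd]
  | succ L ih =>
    obtain ⟨P, hP, hlim⟩ := ih
    refine ⟨Matrix.fromBlocks 1 0 0 0 * P, ?_, ?_⟩
    · rw [← Matrix.fromBlocks_toBlocks P, Matrix.fromBlocks_multiply, hP]
      simp
    have step : Tendsto (fun t => Matrix.fromBlocks ((-z t)⁻¹ • V L + 1) ((-z t)⁻¹ • (-1))
        ((-z t)⁻¹ • 1) 0) atTop
        (𝓝 (Matrix.fromBlocks (1 : Matrix n n ℂ) 0 0 (0 : Matrix n n ℂ))) := by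
      have hc : Continuous fun y : ℂ => Matrix.fromBlocks (y • V L + 1) (y • (-1 : Matrix n n ℂ))
          (y • 1) (0 : Matrix n n ℂ) := by
        refine Continuous.matrix_fromBlocks ?_ ?_ ?_ ?_ <;> fun_prop
      have h := (hc.tendsto 0).comp hz
      simp only [zero_smul, zero_add] at h
      exact h
    refine (step.mul hlim).congr' ?_
    filter_upwards [hz0] with t ht
    have hb : Matrix.fromBlocks ((-z t)⁻¹ • V L + 1) ((-z t)⁻¹ • (-1 : Matrix n n ℂ))
        ((-z t)⁻¹ • (1 : Matrix n n ℂ)) (0 : Matrix n n ℂ)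
        = (-z t)⁻¹ • Matrix.fromBlocks (V L - z t • (1 : Matrix n n ℂ)) (-1) 1 0 := by
      rw [Matrix.fromBlocks_smul, smul_sub, smul_smul, smul_zero, inv_neg, neg_mul,
        inv_mul_cancel₀ ht, neg_one_smul, sub_neg_eq_add]
    rw [hb, transferProd_succ, pow_succ', smul_mul_smul_comm]

/-- Right inverse of a block matrix with commuting diagonal blocks of determinant one. -/
lemma fromBlocks_diagonal_mul_adjugate {n : Type*} [Fintype n] [DecidableEq n] (a b c d : n → ℂ)
    (h : ∀ i, a i * d i - b i * c i = 1) :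
    fromBlocks (diagonal a) (diagonal b) (diagonal c) (diagonal d) *
      fromBlocks (diagonal d) (-diagonal b) (-diagonal c) (diagonal a) = 1 := by
  rw [fromBlocks_multiply, ← fromBlocks_one]
  simp only [mul_neg, diagonal_mul_diagonal, diagonal_neg, diagonal_add]
  congr 1
  · rw [← diagonal_one]
    congr 1
    ext i
    linear_combination h i
  · rw [← diagonal_zero]
    congr 1
    ext i
    ring
  · rw [← diagonal_zero]
    congr 1
    ext i
    ring
  · rw [← diagonal_one]
    congr 1
    ext i
    linear_combination h i

lemma P2_mul_mul_conjTranspose_apply {s h : ℕ}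
    (X : Matrix ((Fin s ⊕ Fin h) ⊕ (Fin s ⊕ Fin h)) ((Fin s ⊕ Fin h) ⊕ (Fin s ⊕ Fin h)) ℂ)
    (i j : Fin h) :
    (P2 s h * X * (P2 s h)ᴴ) i j = X (Sum.inl (Sum.inr i)) (Sum.inl (Sum.inr j)) := by
  simp [Matrix.mul_apply, P2, Fintype.sum_sum_type]

/-- The hyperbolic compression, up to the diagonal factors `e^γ / √(2 sinh γ)` on the left and
`1 / √(2 sinh γ)` on the right, for a transfer matrix `G` written in the eigenbasis of `W`. -/
noncomputable def reducedCompression {s h : ℕ} (u w : Fin h → ℂ)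
    (G : Matrix ((Fin s ⊕ Fin h) ⊕ (Fin s ⊕ Fin h)) ((Fin s ⊕ Fin h) ⊕ (Fin s ⊕ Fin h)) ℂ) :
    Matrix (Fin h) (Fin h) ℂ :=
  Matrix.of fun i j =>
    u i * (G (Sum.inl (Sum.inr i)) (Sum.inl (Sum.inr j)) * u j +
        G (Sum.inl (Sum.inr i)) (Sum.inr (Sum.inr j)) * w j) -
      w i * (G (Sum.inr (Sum.inr i)) (Sum.inl (Sum.inr j)) * u j +
        G (Sum.inr (Sum.inr i)) (Sum.inr (Sum.inr j)) * w j)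

/-- Conjugation of a `2N × 2N` matrix by `U ⊕ U`. -/
noncomputable def conjBlocks {n : Type*} [Fintype n] (U : Matrix n n ℂ)
    (T : Matrix (n ⊕ n) (n ⊕ n) ℂ) : Matrix (n ⊕ n) (n ⊕ n) ℂ :=
  fromBlocks Uᴴ 0 0 Uᴴ * T * fromBlocks U 0 0 U

lemma compression_eq {s h : ℕ} {k : Fin s → ℝ} {γ u : Fin h → ℝ}
    {U : Matrix (Fin s ⊕ Fin h) (Fin s ⊕ Fin h) ℂ}
    (hU : U ∈ Matrix.unitaryGroup (Fin s ⊕ Fin h) ℂ)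
    (hu : ∀ j, u j = 1 ∨ u j = -1) (hk : ∀ i, k i ∈ Set.Ioo 0 Real.pi) (hγ : ∀ j, 0 < γ j)
    (T : Matrix ((Fin s ⊕ Fin h) ⊕ (Fin s ⊕ Fin h)) ((Fin s ⊕ Fin h) ⊕ (Fin s ⊕ Fin h)) ℂ) :
    P2 s h * (Mmat s h k γ u U)⁻¹ * T * Mmat s h k γ u U * (P2 s h)ᴴ =
      diagonal (fun j => (((Real.sqrt (2 * Real.sinh (γ j)))⁻¹ * Real.exp (γ j) : ℝ) : ℂ)) *
        reducedCompression (fun j => (u j : ℂ)) (fun j => (Real.exp (-γ j) : ℂ))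
          (conjBlocks U T) *
        diagonal (fun j => (((Real.sqrt (2 * Real.sinh (γ j)))⁻¹ : ℝ) : ℂ)) := by
  have hUU : U * Uᴴ = 1 := Matrix.mem_unitaryGroup_iff.1 hU
  set q : Fin h → ℝ := fun j => (Real.sqrt (2 * Real.sinh (γ j)))⁻¹ with hq
  set p : Fin s → ℝ := fun i => Real.sqrt (Real.sin (k i)) with hp
  have hp0 : ∀ i, p i ≠ 0 := fun i =>
    (Real.sqrt_pos.2 (Real.sin_pos_of_pos_of_lt_pi (hk i).1 (hk i).2)).ne'
  have hqq : ∀ j, q j * q j * (Real.exp (γ j) - Real.exp (-γ j)) = 1 := fun j => by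
    have hs : 0 < 2 * Real.sinh (γ j) := by
      have := Real.sinh_pos_iff.2 (hγ j)
      positivity
    have h1 : Real.exp (γ j) - Real.exp (-γ j) = 2 * Real.sinh (γ j) := by
      rw [Real.sinh_eq]; ring
    rw [h1, hq]
    simp only
    rw [← mul_inv, Real.mul_self_sqrt hs.le, inv_mul_cancel₀ hs.ne']
  have huu : ∀ j, u j * u j = 1 := fun j => by rcases hu j with h | h <;> simp [h]
  set a : Fin s ⊕ Fin h → ℂ :=
    Sum.elim (fun i => (((p i)⁻¹ : ℝ) : ℂ)) (fun j => ((u j * q j : ℝ) : ℂ)) with ha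
  set b : Fin s ⊕ Fin h → ℂ := Sum.elim 0 (fun j => ((q j : ℝ) : ℂ)) with hb
  set c : Fin s ⊕ Fin h → ℂ :=
    Sum.elim (fun i => ((Real.cos (k i) * (p i)⁻¹ : ℝ) : ℂ))
      (fun j => ((Real.exp (-γ j) * q j : ℝ) : ℂ)) with hc
  set d : Fin s ⊕ Fin h → ℂ :=
    Sum.elim (fun i => ((p i : ℝ) : ℂ)) (fun j => ((u j * Real.exp (γ j) * q j : ℝ) : ℂ)) with hd
  have hdet : ∀ i, a i * d i - b i * c i = 1 := by
    rintro (i | j)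
    · simp [ha, hb, hc, hd, hp0 i]
    · simp only [ha, hb, hc, hd, Sum.elim_inr]
      norm_cast
      linear_combination hqq j + q j * q j * Real.exp (γ j) * huu j
  have hM : Mmat s h k γ u U = fromBlocks U 0 0 U *
      fromBlocks (diagonal a) (diagonal b) (diagonal c) (diagonal d) := by
    rw [Mmat, ha, hb, hc, hd]
    simp only [← fromBlocks_diagonal]
    congr
    exact diagonal_zero.symm
  have hinv : (Mmat s h k γ u U)⁻¹ =
      fromBlocks (diagonal d) (-diagonal b) (-diagonal c) (diagonal a) *
        fromBlocks Uᴴ 0 0 Uᴴ := by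
    refine Matrix.inv_eq_right_inv ?_
    rw [hM, Matrix.mul_assoc, ← Matrix.mul_assoc (fromBlocks (diagonal a) _ _ _),
      fromBlocks_diagonal_mul_adjugate a b c d hdet, Matrix.one_mul, fromBlocks_multiply]
    simp [hUU]
  rw [hinv, hM]
  have hassoc : P2 s h * (fromBlocks (diagonal d) (-diagonal b) (-diagonal c) (diagonal a) *
        fromBlocks Uᴴ 0 0 Uᴴ) * T * (fromBlocks U 0 0 U *
      fromBlocks (diagonal a) (diagonal b) (diagonal c) (diagonal d)) * (P2 s h)ᴴ =
      P2 s h * (fromBlocks (diagonal d) (-diagonal b) (-diagonal c) (diagonal a) *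
        conjBlocks U T *
        fromBlocks (diagonal a) (diagonal b) (diagonal c) (diagonal d)) * (P2 s h)ᴴ := by
    simp only [conjBlocks, Matrix.mul_assoc]
  rw [hassoc]
  ext i j
  rw [P2_mul_mul_conjTranspose_apply, ← fromBlocks_toBlocks (conjBlocks U T), fromBlocks_multiply,
    fromBlocks_multiply, fromBlocks_apply₁₁]
  simp only [Matrix.add_apply, Matrix.mul_diagonal, Matrix.diagonal_mul, Matrix.neg_mul,
    Matrix.neg_apply, ha, hb, hc, hd, Sum.elim_inr, toBlocks₁₁, toBlocks₁₂, toBlocks₂₁,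
    toBlocks₂₂, reducedCompression, Matrix.of_apply, fromBlocks_apply₁₁, fromBlocks_apply₁₂,
    fromBlocks_apply₂₁, fromBlocks_apply₂₂]
  have he : ((Real.exp (γ i) : ℝ) : ℂ) * ((Real.exp (-γ i) : ℝ) : ℂ) = 1 := by
    norm_cast
    rw [← Real.exp_add, add_neg_cancel, Real.exp_zero]
  rw [show (Real.sqrt (2 * Real.sinh (γ i)))⁻¹ = q i from rfl,
    show (Real.sqrt (2 * Real.sinh (γ j)))⁻¹ = q j from rfl]
  push_cast
  push_cast at he
  linear_combination ((q i : ℂ) * q j *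
    (conjBlocks U T (Sum.inr (Sum.inr i)) (Sum.inl (Sum.inr j)) * u j +
      conjBlocks U T (Sum.inr (Sum.inr i)) (Sum.inr (Sum.inr j)) * Complex.exp (-γ j))) * he

lemma analyticAt_matrix_mul {l m n : Type*} [Fintype m] {f : ℂ → Matrix l m ℂ}
    {g : ℂ → Matrix m n ℂ} {z : ℂ} (hf : ∀ i j, AnalyticAt ℂ (fun w => f w i j) z)
    (hg : ∀ i j, AnalyticAt ℂ (fun w => g w i j) z) (i : l) (j : n) :
    AnalyticAt ℂ (fun w => (f w * g w) i j) z := by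
  simp only [Matrix.mul_apply]
  exact Finset.analyticAt_fun_sum _ fun l _ => (hf i l).mul (hg l j)

lemma analyticAt_matrix_det {n : Type*} [Fintype n] [DecidableEq n] {f : ℂ → Matrix n n ℂ}
    {z : ℂ} (hf : ∀ i j, AnalyticAt ℂ (fun w => f w i j) z) :
    AnalyticAt ℂ (fun w => (f w).det) z := by
  simp only [Matrix.det_apply']
  exact Finset.analyticAt_fun_sum _ fun σ _ =>
    analyticAt_const.mul (Finset.analyticAt_fun_prod _ fun i _ => hf _ _)

/-- An analytic function on a preconnected set that is not identically zero has finitely many zeros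
in every compact subset. -/
lemma finite_zeros_of_isCompact {f : ℂ → ℂ} {Ω K : Set ℂ} (hf : AnalyticOnNhd ℂ f Ω)
    (hΩ : IsPreconnected Ω) (hK : IsCompact K) (hKΩ : K ⊆ Ω) {z₀ : ℂ} (hz₀ : z₀ ∈ Ω)
    (hfz₀ : f z₀ ≠ 0) : {z ∈ K | f z = 0}.Finite := by
  by_contra hinf
  obtain ⟨x, hxK, hx⟩ := Set.Infinite.exists_accPt_of_subset_isCompact hinf hK fun z hz => hz.1
  refine hfz₀ (hf.eqOn_zero_of_preconnected_of_frequently_eq_zero hΩ (hKΩ hxK) ?_ hz₀)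
  exact (accPt_iff_frequently_nhdsNE.1 hx).mono fun z hz => hz.2

/-- The value of `2 cosh γ` in a hyperbolic channel, as a function of the complex energy. -/
noncomputable def hypParam (u lam : ℝ) (z : ℂ) : ℂ := -u * (z - lam)

lemma hypParam_re (u lam : ℝ) (z : ℂ) : (hypParam u lam z).re = -u * (z.re - lam) := by
  simp [hypParam]

/-- The analytic extension of the compressed transfer matrix. -/
noncomputable def extendedCompression {s h : ℕ} (lam u : Fin h → ℝ)
    (U : Matrix (Fin s ⊕ Fin h) (Fin s ⊕ Fin h) ℂ)
    (V : ℕ → Matrix (Fin s ⊕ Fin h) (Fin s ⊕ Fin h) ℂ) (L : ℕ) (z : ℂ) :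
    Matrix (Fin h) (Fin h) ℂ :=
  diagonal (fun j => hypNormalizer (hypParam (u j) (lam j) z) *
      growthFactor (hypParam (u j) (lam j) z)) *
    reducedCompression (fun j => (u j : ℂ)) (fun j => decayFactor (hypParam (u j) (lam j) z))
      (conjBlocks U (transferProd V L z)) *
    diagonal (fun j => hypNormalizer (hypParam (u j) (lam j) z))

lemma analyticAt_diagonal {n : Type*} [DecidableEq n] {f : ℂ → n → ℂ} {z : ℂ}
    (hf : ∀ i, AnalyticAt ℂ (fun w => f w i) z) (i j : n) :
    AnalyticAt ℂ (fun w => diagonal (f w) i j) z := by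
  by_cases hij : i = j
  · subst hij
    simpa using hf i
  · simpa [hij] using analyticAt_const

lemma analyticAt_extendedCompression {s h : ℕ} {lam u : Fin h → ℝ}
    (U : Matrix (Fin s ⊕ Fin h) (Fin s ⊕ Fin h) ℂ)
    (V : ℕ → Matrix (Fin s ⊕ Fin h) (Fin s ⊕ Fin h) ℂ) (L : ℕ) {z : ℂ}
    (hz : ∀ j, 2 < -u j * (z.re - lam j)) (i j : Fin h) :
    AnalyticAt ℂ (fun w => extendedCompression lam u U V L w i j) z := by
  have hx : ∀ j, AnalyticAt ℂ (fun w => hypParam (u j) (lam j) w) z := fun j => by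
    unfold hypParam
    fun_prop
  have hre : ∀ j, 2 < (hypParam (u j) (lam j) z).re := fun j => by
    rw [hypParam_re]
    exact hz j
  have hn : ∀ j, AnalyticAt ℂ (fun w => hypNormalizer (hypParam (u j) (lam j) w)) z := fun j =>
    (analyticAt_hypNormalizer (hre j)).fun_comp (hx j)
  have hg : ∀ j, AnalyticAt ℂ (fun w => growthFactor (hypParam (u j) (lam j) w)) z := fun j =>
    (analyticAt_growthFactor (hre j)).fun_comp (hx j)
  have hd : ∀ j, AnalyticAt ℂ (fun w => decayFactor (hypParam (u j) (lam j) w)) z := fun j =>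
    (analyticAt_decayFactor (hre j)).fun_comp (hx j)
  have hT : ∀ i j, AnalyticAt ℂ (fun w => conjBlocks U (transferProd V L w) i j) z :=
    analyticAt_matrix_mul (analyticAt_matrix_mul (fun _ _ => analyticAt_const)
      (analyticAt_transferProd V L z)) fun _ _ => analyticAt_const
  refine analyticAt_matrix_mul (analyticAt_matrix_mul
    (analyticAt_diagonal fun j => (hn j).mul (hg j)) fun i j => ?_) (analyticAt_diagonal hn) i j
  have key : ∀ p q, AnalyticAt ℂ (fun w => conjBlocks U (transferProd V L w) p (Sum.inl (Sum.inr j))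
      * (u j : ℂ) + conjBlocks U (transferProd V L w) q (Sum.inr (Sum.inr j))
      * decayFactor (hypParam (u j) (lam j) w)) z := fun p q =>
    ((hT _ _).mul analyticAt_const).add ((hT _ _).mul (hd j))
  exact (analyticAt_const.mul (key _ _)).sub ((hd i).mul (key _ _))

open Filter Topology in
/-- Far up a vertical line, the determinant of the extended compression is nonzero. -/
lemma exists_det_extendedCompression_ne_zero {s h : ℕ} {lam u : Fin h → ℝ}
    {U : Matrix (Fin s ⊕ Fin h) (Fin s ⊕ Fin h) ℂ}
    (hU : U ∈ Matrix.unitaryGroup (Fin s ⊕ Fin h) ℂ) (hu : ∀ j, u j = 1 ∨ u j = -1)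
    (V : ℕ → Matrix (Fin s ⊕ Fin h) (Fin s ⊕ Fin h) ℂ) (L : ℕ) {E : ℝ}
    (hE : ∀ j, 2 < -u j * (E - lam j)) :
    ∃ z : ℂ, z.re = E ∧ (extendedCompression lam u U V L z).det ≠ 0 := by
  have hUU : Uᴴ * U = 1 := Matrix.mem_unitaryGroup_iff'.1 hU
  set z : ℝ → ℂ := fun t => E + t * Complex.I with hz
  have hre : ∀ t, (z t).re = E := fun t => by simp [hz]
  have him : ∀ t, (z t).im = t := fun t => by simp [hz]
  have hz0 : ∀ᶠ t in atTop, z t ≠ 0 := by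
    filter_upwards [eventually_gt_atTop 0] with t ht h0
    have := him t
    rw [h0] at this
    simp at this
    linarith
  have hnorm : Tendsto (fun t => ‖z t‖) atTop atTop :=
    tendsto_atTop_mono (fun t => (le_abs_self t).trans (by
      have := Complex.abs_im_le_norm (z t)
      rwa [him] at this)) tendsto_id
  have hinv : Tendsto (fun t => (-z t)⁻¹) atTop (𝓝 0) := by
    refine tendsto_zero_iff_norm_tendsto_zero.2 ?_
    simpa [Function.comp_def] using tendsto_inv_atTop_zero.comp hnorm
  have hpre : ∀ j t, 2 < (hypParam (u j) (lam j) (z t)).re := fun j t => by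
    rw [hypParam_re, hre]
    exact hE j
  have hdecay : ∀ j, Tendsto (fun t => decayFactor (hypParam (u j) (lam j) (z t))) atTop (𝓝 0) := by
    intro j
    refine squeeze_zero_norm' ?_ (by simpa using tendsto_inv_atTop_zero.const_mul (8 : ℝ))
    filter_upwards [eventually_gt_atTop 0] with t ht
    have h1 := norm_sub_two_le_growthFactor (hpre j t)
    have h2 := congrArg norm (decayFactor_mul_growthFactor (hpre j t))
    rw [norm_mul, norm_one] at h2
    have h3 : t ≤ ‖hypParam (u j) (lam j) (z t) - 2‖ := by
      refine le_trans ?_ (Complex.abs_im_le_norm _)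
      have : (hypParam (u j) (lam j) (z t) - 2).im = -u j * t := by simp [hypParam, him]
      rw [this]
      rcases hu j with h | h <;> simp [h, le_abs_self]
    rw [← div_eq_mul_inv, le_div_iff₀ ht]
    nlinarith [norm_nonneg (decayFactor (hypParam (u j) (lam j) (z t)))]
  obtain ⟨P, hP, hlim⟩ := exists_tendsto_transferProd V L hinv hz0
  have hconj : Tendsto (fun t => ((-z t)⁻¹) ^ L • conjBlocks U (transferProd V L (z t))) atTop
      (𝓝 (conjBlocks U P)) := by
    have := (hlim.const_mul (fromBlocks Uᴴ 0 0 Uᴴ)).mul_const (fromBlocks U 0 0 U)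
    simpa only [conjBlocks, Matrix.mul_smul, Matrix.smul_mul] using this
  have hentry : ∀ p q, Tendsto (fun t => ((-z t)⁻¹) ^ L *
      conjBlocks U (transferProd V L (z t)) p q) atTop (𝓝 (conjBlocks U P p q)) := fun p q =>
    (tendsto_pi_nhds.1 (tendsto_pi_nhds.1 hconj p) q)
  have hP11 : ∀ i j, conjBlocks U P (Sum.inl i) (Sum.inl j) = (1 : Matrix _ _ ℂ) i j := by
    intro i j
    rw [conjBlocks, ← fromBlocks_toBlocks P, fromBlocks_multiply, fromBlocks_multiply, hP,
      fromBlocks_apply₁₁]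
    simp [hUU]
  have hred : Tendsto (fun t => ((-z t)⁻¹) ^ L • reducedCompression (fun j => (u j : ℂ))
      (fun j => decayFactor (hypParam (u j) (lam j) (z t)))
      (conjBlocks U (transferProd V L (z t)))) atTop (𝓝 1) := by
    refine tendsto_pi_nhds.2 fun i => tendsto_pi_nhds.2 fun j => ?_
    have key : ∀ p, Tendsto (fun t => ((-z t)⁻¹) ^ L *
        conjBlocks U (transferProd V L (z t)) p (Sum.inl (Sum.inr j)) * (u j : ℂ) +
        ((-z t)⁻¹) ^ L * conjBlocks U (transferProd V L (z t)) p (Sum.inr (Sum.inr j)) *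
          decayFactor (hypParam (u j) (lam j) (z t))) atTop
        (𝓝 (conjBlocks U P p (Sum.inl (Sum.inr j)) * (u j : ℂ) +
          conjBlocks U P p (Sum.inr (Sum.inr j)) * 0)) := fun p =>
      ((hentry _ _).mul_const _).add ((hentry _ _).mul (hdecay j))
    have hcomb := ((key (Sum.inl (Sum.inr i))).const_mul (u i : ℂ)).sub
      ((hdecay i).mul (key (Sum.inr (Sum.inr i))))
    have hval : (u i : ℂ) * (conjBlocks U P (Sum.inl (Sum.inr i)) (Sum.inl (Sum.inr j)) * (u j : ℂ) +
          conjBlocks U P (Sum.inl (Sum.inr i)) (Sum.inr (Sum.inr j)) * 0) -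
        0 * (conjBlocks U P (Sum.inr (Sum.inr i)) (Sum.inl (Sum.inr j)) * (u j : ℂ) +
          conjBlocks U P (Sum.inr (Sum.inr i)) (Sum.inr (Sum.inr j)) * 0)
        = (1 : Matrix (Fin h) (Fin h) ℂ) i j := by
      rw [hP11]
      by_cases hij : i = j
      · subst hij
        rcases hu i with hi | hi <;> simp [hi]
      · simp [hij]
    rw [hval] at hcomb
    refine hcomb.congr fun t => ?_
    simp only [reducedCompression, Matrix.smul_apply, Matrix.of_apply, smul_eq_mul]
    ring
  have hdet := ((continuous_id.matrix_det).tendsto (1 : Matrix (Fin h) (Fin h) ℂ)).comp hred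
  have hne := hdet.eventually_ne (by simp : (1 : Matrix (Fin h) (Fin h) ℂ).det ≠ 0)
  obtain ⟨t, ht⟩ := hne.exists
  refine ⟨z t, hre t, ?_⟩
  simp only [Function.comp_apply, id, Matrix.det_smul] at ht
  have hn : ∀ x, hypNormalizer x ≠ 0 := fun x => Complex.exp_ne_zero _
  have hg : ∀ j, growthFactor (hypParam (u j) (lam j) (z t)) ≠ 0 := fun j h0 => by
    have := decayFactor_mul_growthFactor (hpre j t)
    simp [h0] at this
  rw [extendedCompression, Matrix.det_mul, Matrix.det_mul, Matrix.det_diagonal,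
    Matrix.det_diagonal]
  exact mul_ne_zero (mul_ne_zero
    (Finset.prod_ne_zero_iff.2 fun j _ => mul_ne_zero (hn _) (hg j)) (right_ne_zero_of_mul ht))
    (Finset.prod_ne_zero_iff.2 fun j _ => hn _)

/-- On an interval I free of parabolic channels, the compression
    A_E = P₂ M(E)⁻¹ 𝒯^E_{0,L} M(E) P₂* of the conjugated transfer matrix to the
    hyperbolic block extends to a function analytic on the strip I + iℝ, and
    det A_E vanishes at only finitely many E ∈ I; hence A_E is invertible for all
    but finitely many E ∈ I. -/
theorem stmt16 (s h : ℕ) (lam : Fin s ⊕ Fin h → ℝ)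
    (U : Matrix (Fin s ⊕ Fin h) (Fin s ⊕ Fin h) ℂ)
    (hU : U ∈ Matrix.unitaryGroup (Fin s ⊕ Fin h) ℂ)
    (I : Set ℝ) (hbdd : Bornology.IsBounded I)
    (hnp : ∀ E ∈ closure I, ∀ i, |E - lam i| ≠ 2)
    (hell : ∀ E ∈ I, ∀ i, |E - lam (Sum.inl i)| < 2)
    (hhyp : ∀ E ∈ I, ∀ j, 2 < |E - lam (Sum.inr j)|)
    (k : ℝ → Fin s → ℝ) (γ : ℝ → Fin h → ℝ) (u : Fin h → ℝ)
    (hu : ∀ j, u j = 1 ∨ u j = -1)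
    (hk : ∀ E ∈ I, ∀ i, k E i ∈ Set.Ioo 0 Real.pi ∧
      E = -2 * Real.cos (k E i) + lam (Sum.inl i))
    (hγ : ∀ E ∈ I, ∀ j, 0 < γ E j ∧ E = -2 * u j * Real.cosh (γ E j) + lam (Sum.inr j))
    (L : ℕ) (V : ℕ → Matrix (Fin s ⊕ Fin h) (Fin s ⊕ Fin h) ℂ)
    (hV : ∀ n, (V n).IsHermitian)
    (𝒯 : ℝ → Matrix ((Fin s ⊕ Fin h) ⊕ (Fin s ⊕ Fin h)) ((Fin s ⊕ Fin h) ⊕ (Fin s ⊕ Fin h)) ℂ)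
    (h𝒯 : ∀ E : ℝ, 𝒯 E =
      ((List.range L).reverse.map fun n =>
        Matrix.fromBlocks (V n - (E : ℂ) • 1) (-1) 1 0).prod)
    (A : ℝ → Matrix (Fin h) (Fin h) ℂ)
    (hA : ∀ E : ℝ, A E =
      P2 s h * (Mmat s h (k E) (γ E) u U)⁻¹ * 𝒯 E * Mmat s h (k E) (γ E) u U * (P2 s h)ᴴ) :
    (∃ F : ℂ → Matrix (Fin h) (Fin h) ℂ,
        (∀ E ∈ I, F (E : ℂ) = A E) ∧
        (∀ z : ℂ, z.re ∈ I → ∀ i j, AnalyticAt ℂ (fun w => F w i j) z)) ∧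
    {E ∈ I | ¬ IsUnit (A E)}.Finite := by
  
  set lamH : Fin h → ℝ := fun j => lam (Sum.inr j) with hlamH
  set F := extendedCompression lamH u U V L with hF
  have hparam : ∀ E ∈ I, ∀ j, hypParam (u j) (lamH j) (E : ℂ)
      = ((2 * Real.cosh (γ E j) : ℝ) : ℂ) := fun E hE j => by
    have h1 : -u j * (E - lamH j) = 2 * Real.cosh (γ E j) := by
      have h2 := (hγ E hE j).2
      rcases hu j with h | h <;> rw [h] at h2 ⊢ <;> simp only [hlamH] <;> linarith
    rw [← h1, hypParam]
    push_cast
    rfl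
  have hFA : ∀ E ∈ I, F (E : ℂ) = A E := fun E hE => by
    have hT : 𝒯 E = transferProd V L E := h𝒯 E
    rw [hA, hT, compression_eq hU hu (fun i => (hk E hE i).1) (fun j => (hγ E hE j).1), hF,
      extendedCompression]
    simp only [hparam E hE, growthFactor_two_cosh (hγ E hE _).1, decayFactor_two_cosh (hγ E hE _).1,
      hypNormalizer_two_cosh (hγ E hE _).1]
    simp only [Complex.ofReal_mul]
  have hI : ∀ E ∈ I, ∀ j, 2 < -u j * (E - lamH j) := fun E hE j => by
    have h1 := congrArg Complex.re (hparam E hE j)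
    rw [hypParam_re, Complex.ofReal_re, Complex.ofReal_re] at h1
    rw [h1]
    linarith [Real.one_lt_cosh.2 (hγ E hE j).1.ne']
  have hIcl : ∀ E ∈ closure I, ∀ j, 2 < -u j * (E - lamH j) := fun E hE j => by
    have hle : 2 ≤ -u j * (E - lamH j) := by
      have hc : IsClosed {x : ℝ | 2 ≤ -u j * (x - lamH j)} :=
        isClosed_le continuous_const (by fun_prop)
      exact closure_minimal (fun x hx => (hI x hx j).le) hc hE
    refine lt_of_le_of_ne hle fun h2 => hnp E hE (Sum.inr j) ?_
    have h3 : |-u j * (E - lamH j)| = 2 := by rw [← h2]; norm_num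
    have h4 : |-u j| = 1 := by rcases hu j with h | h <;> simp [h]
    rwa [abs_mul, h4, one_mul] at h3
  refine ⟨⟨F, hFA, fun z hz => analyticAt_extendedCompression U V L (hI _ hz)⟩, ?_⟩
  rcases I.eq_empty_or_nonempty with rfl | ⟨E₀, hE₀⟩
  · simp
  set Ω : Set ℂ := {z | ∀ j, 2 < -u j * (z.re - lamH j)} with hΩ
  have hΩc : IsPreconnected Ω := by
    refine Convex.isPreconnected ?_
    intro x hx y hy a b ha hb hab j
    have h1 : (a • x + b • y).re = a * x.re + b * y.re := by simp
    have h2 : -u j * (a * x.re + b * y.re - lamH j)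
        = a * (-u j * (x.re - lamH j)) + b * (-u j * (y.re - lamH j)) := by
      linear_combination (-u j * lamH j) * hab
    rw [h1, h2]
    exact (convex_Ioi (2 : ℝ)) (hx j) (hy j) ha hb hab
  obtain ⟨z₀, hz₀, hdet⟩ := exists_det_extendedCompression_ne_zero hU hu V L (hI E₀ hE₀)
  have hfin := finite_zeros_of_isCompact (f := fun z => (F z).det) (Ω := Ω)
    (K := Complex.ofReal '' closure I)
    (fun z hz => analyticAt_matrix_det (analyticAt_extendedCompression U V L hz)) hΩc
    (hbdd.isCompact_closure.image Complex.continuous_ofReal)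
    (by rintro _ ⟨E, hE, rfl⟩; exact hIcl E hE) (z₀ := z₀)
    (by rw [hΩ, Set.mem_ofPred_eq, hz₀]; exact hI E₀ hE₀) hdet
  refine (hfin.preimage (f := Complex.ofReal) Complex.ofReal_injective.injOn).subset ?_
  rintro E ⟨hE, hEA⟩
  refine ⟨⟨E, subset_closure hE, rfl⟩, ?_⟩
  rw [Matrix.isUnit_iff_isUnit_det, isUnit_iff_ne_zero, not_not] at hEA
  rw [hFA E hE, hEA]
end
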